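/- arXiv:1307.5923 — 2 statements merged into one kernel-verified Lean document; each statement's English description precedes it below -/
import Mathlib

section
/- For every integer n ≥ 0, every integer 0 ≤ i ≤ n, and every (x,y) ∈ B₂: x·Q_n^i(x,y) = a_{i,n}·Q_{n+1}^i(x,y) + a_{i,n−1}·Q_{n−1}^i(x,y), where the second term on the right-hand side is taken to be 0 when i = n. -/
open MeasureTheory Real Filter

/-- The Gegenbauer polynomials `C_n^λ`, defined by their triple recursion. -/
noncomputable def gegenbauer (lam : ℝ) : ℕ → ℝ → ℝ
  | 0, _ => 1
  | 1, t => 2 * lam * t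
  | (n + 2), t =>
      (2 * (((n : ℝ) + 1) + lam) / ((n : ℝ) + 2)) * t * gegenbauer lam (n + 1) t
        - ((((n : ℝ) + 1) + 2 * lam - 1) / ((n : ℝ) + 2)) * gegenbauer lam n t

/-- The open unit disk in `ℝ²`. -/
def unitDisk : Set (ℝ × ℝ) := {p | p.1 ^ 2 + p.2 ^ 2 < 1}

/-- The normalization constant `h_{k,n}`. -/
noncomputable def hConst (k n : ℕ) : ℝ :=
  Real.sqrt ((π / 4 ^ k) * (Nat.factorial (n + k + 1)) /
    (((n : ℝ) + 1) * (2 * (k : ℝ) + 1) * ((Nat.factorial k : ℝ)) ^ 2 *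
      (Nat.factorial (n - k) : ℝ)))

/-- The orthonormal polynomial basis `Q_n^k` on the unit disk. -/
noncomputable def Q2 (n k : ℕ) (x y : ℝ) : ℝ :=
  (1 / hConst k n) * gegenbauer ((k : ℝ) + 1) (n - k) x *
    (1 - x ^ 2) ^ ((k : ℝ) / 2) * gegenbauer (1 / 2) k (y / Real.sqrt (1 - x ^ 2))

/-- The recursion coefficient `a_{k,n}`. -/
noncomputable def aCoef (k n : ℤ) : ℝ :=
  (1 / 2) * Real.sqrt (((n : ℝ) - k + 1) * ((n : ℝ) + k + 2) /
    (((n : ℝ) + 1) * ((n : ℝ) + 2)))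

/-- The recursion coefficient `d_{k,n}`. -/
noncomputable def dCoef (k n : ℤ) : ℝ :=
  (((k : ℝ) + 1) / 2) * Real.sqrt (((n : ℝ) + k + 3) * ((n : ℝ) + k + 2) /
    ((2 * (k : ℝ) + 1) * (2 * (k : ℝ) + 3) * ((n : ℝ) + 1) * ((n : ℝ) + 2)))

/-- The recursion coefficient `c_{k,n}`. -/
noncomputable def cCoef (k n : ℤ) : ℝ :=
  -((k : ℝ) / 2) * Real.sqrt (((n : ℝ) - k + 1) * ((n : ℝ) - k + 2) /
    (((n : ℝ) + 1) * ((n : ℝ) + 2) * (2 * (k : ℝ) - 1) * (2 * (k : ℝ) + 1)))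

lemma hConst_pos (k n : ℕ) : 0 < hConst k n :=
  Real.sqrt_pos.mpr (by positivity)

lemma hConst_sq (k m : ℕ) :
    hConst k (k + m) ^ 2 = (π / 4 ^ k) * (Nat.factorial (k + m + k + 1)) /
      (((k : ℝ) + m + 1) * (2 * (k : ℝ) + 1) * ((Nat.factorial k : ℝ)) ^ 2 *
        (Nat.factorial m : ℝ)) := by
  rw [hConst, Real.sq_sqrt (by positivity), Nat.add_sub_cancel_left]
  push_cast
  rfl

lemma aCoef_nonneg (k n : ℤ) : 0 ≤ aCoef k n :=
  mul_nonneg (by norm_num) (Real.sqrt_nonneg _)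

lemma aCoef_sq (k m : ℕ) :
    aCoef (k : ℤ) ((k + m : ℕ) : ℤ) ^ 2 = (1 / 4) * (((m : ℝ) + 1) * (2 * k + m + 2) /
      (((k : ℝ) + m + 1) * (k + m + 2))) := by
  have h : ((((k + m : ℕ) : ℤ) : ℝ) - ((k : ℤ) : ℝ) + 1) * ((((k + m : ℕ) : ℤ) : ℝ) + (k : ℤ) + 2) /
      (((((k + m : ℕ) : ℤ) : ℝ) + 1) * ((((k + m : ℕ) : ℤ) : ℝ) + 2)) =
      ((m : ℝ) + 1) * (2 * k + m + 2) / (((k : ℝ) + m + 1) * (k + m + 2)) := by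
    push_cast
    ring
  rw [aCoef, h, mul_pow, Real.sq_sqrt (by positivity)]
  norm_num

lemma hConst_sq_succ (k m : ℕ) :
    hConst k (k + m + 1) ^ 2 * (((k : ℝ) + m + 2) * (m + 1)) =
      hConst k (k + m) ^ 2 * (((k : ℝ) + m + 1) * (2 * k + m + 2)) := by
  rw [add_assoc k m 1, hConst_sq, hConst_sq, Nat.factorial_succ m,
    show k + (m + 1) + k + 1 = (k + m + k + 1) + 1 by ring, Nat.factorial_succ (k + m + k + 1)]
  push_cast
  field_simp
  ring

lemma aCoef_mul_hConst (k m : ℕ) :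
    aCoef (k : ℤ) ((k + m : ℕ) : ℤ) * hConst k (k + m) =
      ((m : ℝ) + 1) / (2 * (k + m + 1)) * hConst k (k + m + 1) := by
  have h₁ := hConst_pos k (k + m)
  have h₂ := hConst_pos k (k + m + 1)
  refine (pow_left_inj₀ (mul_nonneg (aCoef_nonneg _ _) h₁.le) (by positivity) two_ne_zero).mp ?_
  have h := hConst_sq_succ k m
  rw [mul_pow, mul_pow, aCoef_sq]
  field_simp
  linear_combination (-4 : ℝ) * h

lemma aCoef_mul_hConst_succ (k m : ℕ) :
    aCoef (k : ℤ) ((k + m : ℕ) : ℤ) * hConst k (k + m + 1) =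
      (2 * (k : ℝ) + m + 2) / (2 * (k + m + 2)) * hConst k (k + m) := by
  have h₁ := hConst_pos k (k + m)
  have h₂ := hConst_pos k (k + m + 1)
  refine (pow_left_inj₀ (mul_nonneg (aCoef_nonneg _ _) h₂.le) (by positivity) two_ne_zero).mp ?_
  have h := hConst_sq_succ k m
  rw [mul_pow, mul_pow, aCoef_sq]
  field_simp
  linear_combination (4 : ℝ) * h

lemma aCoef_div_hConst_succ (k m : ℕ) :
    aCoef (k : ℤ) ((k + m : ℕ) : ℤ) * (1 / hConst k (k + m + 1)) =
      ((m : ℝ) + 1) / (2 * (k + m + 1)) * (1 / hConst k (k + m)) := by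
  have h₁ := (hConst_pos k (k + m)).ne'
  have h₂ := (hConst_pos k (k + m + 1)).ne'
  rw [mul_one_div, mul_one_div, div_eq_div_iff h₂ h₁, aCoef_mul_hConst]

lemma aCoef_div_hConst (k m : ℕ) :
    aCoef (k : ℤ) ((k + m : ℕ) : ℤ) * (1 / hConst k (k + m)) =
      (2 * (k : ℝ) + m + 2) / (2 * (k + m + 2)) * (1 / hConst k (k + m + 1)) := by
  have h₁ := (hConst_pos k (k + m)).ne'
  have h₂ := (hConst_pos k (k + m + 1)).ne'
  rw [mul_one_div, mul_one_div, div_eq_div_iff h₁ h₂, aCoef_mul_hConst_succ]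

lemma mul_gegenbauer_succ {lam : ℝ} (hlam : 0 < lam) (m : ℕ) (t : ℝ) :
    t * gegenbauer lam (m + 1) t =
      ((m : ℝ) + 2) / (2 * (m + 1 + lam)) * gegenbauer lam (m + 2) t +
        ((m : ℝ) + 2 * lam) / (2 * (m + 1 + lam)) * gegenbauer lam m t := by
  rw [gegenbauer]
  field_simp
  ring

/-- the `x`-direction triple recursion relation for the `Q_n^i`. -/
theorem Q2_recursion_x (n i : ℕ) (hi : i ≤ n) (x y : ℝ)
    (hxy : (x, y) ∈ unitDisk) :
    x * Q2 n i x y =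
      aCoef i n * Q2 (n + 1) i x y +
        (if i = n then 0 else aCoef (i : ℤ) ((n : ℤ) - 1) * Q2 (n - 1) i x y) := by
  obtain ⟨m, rfl⟩ := Nat.exists_eq_add_of_le hi
  have ha := aCoef_div_hConst_succ i m
  rw [Q2, Q2, show i + m - i = m by omega, show i + m + 1 - i = m + 1 by omega]
  cases m with
  | zero =>
    rw [if_pos (by omega), gegenbauer, gegenbauer]
    generalize (1 - x ^ 2) ^ ((i : ℝ) / 2) = r
    generalize gegenbauer (1 / 2) i _ = z
    have h : (i : ℝ) + 1 ≠ 0 := by positivity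
    have ha' : aCoef (i : ℤ) ((i + 0 : ℕ) : ℤ) * (1 / hConst i (i + 0 + 1)) * (2 * (i + 1)) =
        1 / hConst i (i + 0) := by
      rw [ha]
      push_cast
      field_simp
      ring
    linear_combination (-x * r * z) * ha'
  | succ m =>
    have hb := aCoef_div_hConst i m
    rw [if_neg (by omega), Q2, show i + (m + 1) - 1 = i + m by omega,
      show i + m - i = m by omega,
      show (((i + (m + 1) : ℕ) : ℤ) - 1) = ((i + m : ℕ) : ℤ) by push_cast; ring]
    have hg := mul_gegenbauer_succ (lam := (i : ℝ) + 1) (by positivity) m x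
    generalize (1 - x ^ 2) ^ ((i : ℝ) / 2) = r
    generalize gegenbauer (1 / 2) i _ = z
    have e₁ : (((m + 1 : ℕ) : ℝ) + 1) / (2 * (i + (m + 1 : ℕ) + 1)) =
        ((m : ℝ) + 2) / (2 * (m + 1 + (i + 1))) := by
      push_cast
      congr 1 <;> ring
    have e₂ : (2 * (i : ℝ) + m + 2) / (2 * (i + m + 2)) =
        ((m : ℝ) + 2 * (i + 1)) / (2 * (m + 1 + (i + 1))) := by
      congr 1 <;> ring
    rw [e₁] at ha
    rw [e₂, add_assoc i m 1] at hb
    linear_combination (1 / hConst i (i + (m + 1)) * r * z) * hg -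
      (gegenbauer ((i : ℝ) + 1) (m + 2) x * r * z) * ha -
      (gegenbauer ((i : ℝ) + 1) m x * r * z) * hb
end

section
/- For all integers 0 ≤ k ≤ n: ∫_{B₂} (C_{n−k}^{k+1}(x))²·(1−x²)^k·(C_k^{1/2}(y/√(1−x²)))² dx dy = (π/4^k)·(n+k+1)! / ((n+1)(2k+1)(k!)²(n−k)!), i.e., the normalization constant h_{k,n} is the L²(B₂)-norm of the unnormalized basis function. -/
open MeasureTheory Real Filter

open Polynomial in
/-- The Gegenbauer polynomials as elements of `ℝ[X]`. -/
noncomputable def gegenbauerPoly (lam : ℝ) : ℕ → ℝ[X]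
  | 0 => 1
  | 1 => C (2 * lam) * X
  | (n + 2) =>
      C (2 * (((n : ℝ) + 1) + lam) / ((n : ℝ) + 2)) * X * gegenbauerPoly lam (n + 1)
        - C ((((n : ℝ) + 1) + 2 * lam - 1) / ((n : ℝ) + 2)) * gegenbauerPoly lam n

theorem eval_gegenbauerPoly (lam : ℝ) (n : ℕ) (t : ℝ) :
    (gegenbauerPoly lam n).eval t = gegenbauer lam n t := by
  induction n using Nat.twoStepInduction with
  | zero => simp [gegenbauerPoly, gegenbauer]
  | one => simp [gegenbauerPoly, gegenbauer]
  | more n h₁ h₂ => simp [gegenbauerPoly, gegenbauer, h₁, h₂]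

section Algebra

open Polynomial

theorem gegenbauerPoly_recurrence (lam : ℝ) (n : ℕ) :
    C ((n : ℝ) + 2) * gegenbauerPoly lam (n + 2) =
      C (2 * ((n : ℝ) + 1 + lam)) * X * gegenbauerPoly lam (n + 1)
        - C ((n : ℝ) + 2 * lam) * gegenbauerPoly lam n := by
  have h : (n : ℝ) + 2 ≠ 0 := by positivity
  have e₁ : 2 * ((n : ℝ) + 1 + lam) = (n + 2) * (2 * (((n : ℝ) + 1) + lam) / ((n : ℝ) + 2)) := by
    field_simp
  have e₂ : (n : ℝ) + 2 * lam = (n + 2) * ((((n : ℝ) + 1) + 2 * lam - 1) / ((n : ℝ) + 2)) := by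
    field_simp; ring
  rw [e₂, congrArg C e₁, gegenbauerPoly, C_mul (a := (n : ℝ) + 2), C_mul (a := (n : ℝ) + 2)]
  simp only [mul_sub, mul_assoc]

/-- The two first-order structure relations linking consecutive Gegenbauer polynomials. -/
theorem gegenbauerPoly_structure (lam : ℝ) (n : ℕ) :
    derivative (gegenbauerPoly lam (n + 1)) =
        X * derivative (gegenbauerPoly lam n) + C ((n : ℝ) + 2 * lam) * gegenbauerPoly lam n ∧
      (1 - X ^ 2) * derivative (gegenbauerPoly lam n) =
        C ((n : ℝ) + 2 * lam) * X * gegenbauerPoly lam n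
          - C ((n : ℝ) + 1) * gegenbauerPoly lam (n + 1) := by
  induction n with
  | zero => simp [gegenbauerPoly]
  | succ n ih =>
    obtain ⟨h₁, h₂⟩ := ih
    have hr := gegenbauerPoly_recurrence lam n
    have hd := congrArg derivative hr
    simp only [derivative_mul, derivative_sub, derivative_C, derivative_X, zero_mul, zero_add,
      mul_one] at hd
    have hc : (C ((n : ℝ) + 2) : ℝ[X]) ≠ 0 := by
      rw [Ne, C_eq_zero]; positivity
    simp only [C_add, C_mul, map_ofNat, map_natCast, map_one] at *
    push_cast
    refine ⟨mul_left_cancel₀ hc ?_, ?_⟩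
    · rw [hd, h₁]
      linear_combination -((n : ℝ[X]) + 2 * C lam) * h₂
    · rw [h₁]
      linear_combination X * h₂ + hr

theorem gegenbauerPoly_ode (lam : ℝ) (n : ℕ) :
    (1 - X ^ 2) * derivative (derivative (gegenbauerPoly lam n))
        - C (2 * lam + 1) * X * derivative (gegenbauerPoly lam n)
      = - C ((n : ℝ) * (n + 2 * lam)) * gegenbauerPoly lam n := by
  obtain ⟨h₁, h₂⟩ := gegenbauerPoly_structure lam n
  have hd := congrArg derivative h₂
  simp only [derivative_mul, derivative_sub, derivative_C, derivative_X, derivative_one,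
    derivative_X_pow, zero_mul, zero_add, mul_one] at hd
  simp only [C_add, C_mul, map_ofNat, map_natCast, map_one] at *
  norm_num at hd ⊢
  linear_combination hd - ((n : ℝ[X]) + 1) * h₁

end Algebra

section Norm

open Polynomial

/-- Integration of a polynomial against the ultraspherical weight `(1 - x²) ^ (a / 2)`. -/
noncomputable def ultraInt (a : ℕ) (p : ℝ[X]) : ℝ :=
  ∫ x in (-1 : ℝ)..1, p.eval x * √(1 - x ^ 2) ^ a

theorem ultraInt_integrable (a : ℕ) (p : ℝ[X]) :
    IntervalIntegrable (fun x : ℝ ↦ p.eval x * √(1 - x ^ 2) ^ a) volume (-1) 1 :=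
  Continuous.intervalIntegrable (by fun_prop) _ _

theorem ultraInt_C_mul (a : ℕ) (c : ℝ) (p : ℝ[X]) :
    ultraInt a (C c * p) = c * ultraInt a p := by
  simp only [ultraInt, eval_mul, eval_C, mul_assoc]
  exact intervalIntegral.integral_const_mul _ _

theorem ultraInt_sub (a : ℕ) (p q : ℝ[X]) :
    ultraInt a (p - q) = ultraInt a p - ultraInt a q := by
  simp only [ultraInt, eval_sub, sub_mul]
  exact intervalIntegral.integral_sub (ultraInt_integrable a p) (ultraInt_integrable a q)

theorem ultraInt_pearson (a : ℕ) (p : ℝ[X]) :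
    ultraInt a ((1 - X ^ 2) * derivative p - C ((a : ℝ) + 2) * X * p) = 0 := by
  have key := intervalIntegral.integral_eq_sub_of_hasDerivAt_of_le (a := (-1 : ℝ)) (b := 1)
    (f := fun x : ℝ ↦ p.eval x * √(1 - x ^ 2) ^ (a + 2))
    (f' := fun x : ℝ ↦ ((1 - X ^ 2) * derivative p - C ((a : ℝ) + 2) * X * p).eval x
      * √(1 - x ^ 2) ^ a) (by norm_num) (by fun_prop) ?_ (ultraInt_integrable a _)
  · rw [ultraInt, key]; simp
  · intro x hx
    have hpos : 0 < 1 - x ^ 2 := by nlinarith [hx.1, hx.2]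
    have hs : √(1 - x ^ 2) ≠ 0 := (Real.sqrt_pos.2 hpos).ne'
    have hsq : √(1 - x ^ 2) ^ 2 = 1 - x ^ 2 := Real.sq_sqrt hpos.le
    have hw : HasDerivAt (fun x : ℝ ↦ √(1 - x ^ 2)) (-(2 * x) / (2 * √(1 - x ^ 2))) x := by
      have := ((hasDerivAt_pow 2 x).const_sub 1).sqrt hpos.ne'
      simpa using this
    have := (p.hasDerivAt x).mul (hw.pow (a + 2))
    refine this.congr_deriv ?_
    simp only [Pi.pow_apply, eval_sub, eval_mul, eval_one, eval_pow, eval_X, eval_C]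
    generalize √(1 - x ^ 2) = s at hs hsq ⊢
    rw [← hsq]
    have e : a + 2 - 1 = a + 1 := rfl
    rw [e]
    push_cast
    field_simp
    ring

theorem ultraInt_gegenbauer_orthogonal (a m n : ℕ) (h : m ≠ n) :
    ultraInt a (gegenbauerPoly (((a : ℝ) + 1) / 2) m * gegenbauerPoly (((a : ℝ) + 1) / 2) n)
      = 0 := by
  set lam : ℝ := ((a : ℝ) + 1) / 2 with hl
  have hm := gegenbauerPoly_ode lam m
  have hn := gegenbauerPoly_ode lam n
  have ha : 2 * lam + 1 = (a : ℝ) + 2 := by rw [hl]; ring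
  rw [ha] at hm hn
  set P := gegenbauerPoly lam m
  set Q := gegenbauerPoly lam n
  have hp := ultraInt_pearson a (derivative P * Q - P * derivative Q)
  have e : (1 - X ^ 2) * derivative (derivative P * Q - P * derivative Q)
        - C ((a : ℝ) + 2) * X * (derivative P * Q - P * derivative Q)
      = C ((n : ℝ) * (n + 2 * lam) - m * (m + 2 * lam)) * (P * Q) := by
    rw [C_sub]
    simp only [derivative_sub, derivative_mul]
    linear_combination Q * hm - P * hn
  rw [e, ultraInt_C_mul] at hp
  refine (mul_eq_zero.1 hp).resolve_left fun h0 ↦ ?_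
  have hf : ((n : ℝ) - m) * (n + m + (a + 1)) = 0 := by rw [← h0, hl]; ring
  rcases mul_eq_zero.1 hf with h1 | h1
  · exact h (by exact_mod_cast (sub_eq_zero.1 h1).symm)
  · have : (0 : ℝ) < n + m + (a + 1) := by positivity
    exact this.ne' h1

theorem ultraInt_gegenbauer_sq_succ (a n : ℕ) :
    ((n : ℝ) + 1) * (2 * n + a + 3) *
        ultraInt a (gegenbauerPoly (((a : ℝ) + 1) / 2) (n + 1) ^ 2) =
      (2 * n + a + 1) * (n + a + 1) * ultraInt a (gegenbauerPoly (((a : ℝ) + 1) / 2) n ^ 2) := by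
  have orth := ultraInt_gegenbauer_orthogonal a
  set lam : ℝ := ((a : ℝ) + 1) / 2 with hl
  set G := gegenbauerPoly lam
  have h₁ : ((n : ℝ) + 1) * ultraInt a (G (n + 1) ^ 2)
      = 2 * (n + lam) * ultraInt a (X * G n * G (n + 1)) := by
    cases n with
    | zero =>
      rw [← ultraInt_C_mul, ← ultraInt_C_mul]
      congr 1
      simp [G, gegenbauerPoly]
      ring
    | succ n =>
      have h := congrArg (fun p ↦ ultraInt a (p * G (n + 2))) (gegenbauerPoly_recurrence lam n)
      simp only [sub_mul, ultraInt_sub, mul_assoc, ultraInt_C_mul] at h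
      rw [orth n (n + 2) (by lia)] at h
      push_cast
      rw [sq, mul_assoc X]
      linear_combination h
  have h₂ : 2 * ((n : ℝ) + 1 + lam) * ultraInt a (X * G n * G (n + 1))
      = (n + 2 * lam) * ultraInt a (G n ^ 2) := by
    have h := congrArg (fun p ↦ ultraInt a (p * G n)) (gegenbauerPoly_recurrence lam n)
    simp only [sub_mul, ultraInt_sub, mul_assoc, ultraInt_C_mul] at h
    rw [orth (n + 2) n (by lia)] at h
    rw [sq, mul_assoc X, mul_comm (G n) (G (n + 1))]
    linear_combination -h
  rw [hl] at h₁ h₂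
  linear_combination (2 * (n : ℝ) + a + 3) * h₁ + (2 * (n : ℝ) + a + 1) * h₂

theorem ultraInt_zero_one : ultraInt 0 1 = 2 := by
  simp [ultraInt]; norm_num

theorem ultraInt_one_one : ultraInt 1 1 = π / 2 := by
  simp [ultraInt, integral_sqrt_one_sub_sq]

theorem ultraInt_add_two_one (a : ℕ) :
    ((a : ℝ) + 3) * ultraInt (a + 2) 1 = (a + 2) * ultraInt a 1 := by
  have h := ultraInt_pearson a X
  have e : (1 - X ^ 2) * derivative X - C ((a : ℝ) + 2) * X * X
      = C ((a : ℝ) + 3) * (1 - X ^ 2) - C ((a : ℝ) + 2) * 1 := by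
    simp only [derivative_X, C_add, map_ofNat, map_natCast]
    ring
  have e' : ultraInt (a + 2) 1 = ultraInt a (1 - X ^ 2) := by
    refine intervalIntegral.integral_congr fun x hx ↦ ?_
    rw [Set.uIcc_of_le (by norm_num)] at hx
    have hpos : 0 ≤ 1 - x ^ 2 := by nlinarith [hx.1, hx.2]
    simp only [eval_sub, eval_one, eval_pow, eval_X, one_mul]
    rw [pow_add, Real.sq_sqrt hpos, mul_comm]
  rw [e, ultraInt_sub, ultraInt_C_mul, ultraInt_C_mul] at h
  rw [e']
  linarith

theorem ultraInt_legendre_sq (k : ℕ) :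
    ultraInt 0 (gegenbauerPoly (1 / 2) k ^ 2) = 2 / (2 * k + 1) := by
  induction k with
  | zero => simp [gegenbauerPoly, ultraInt_zero_one]
  | succ k ih =>
    have h := ultraInt_gegenbauer_sq_succ 0 k
    simp only [Nat.cast_zero, zero_add, add_zero] at h
    rw [ih] at h
    have h₁ : (k : ℝ) + 1 ≠ 0 := by positivity
    have h₂ : 2 * (k : ℝ) + 3 ≠ 0 := by positivity
    have h₃ : 2 * (k : ℝ) + 1 ≠ 0 := by positivity
    refine mul_left_cancel₀ (mul_ne_zero h₁ h₂) (h.trans ?_)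
    push_cast
    have h₄ : 2 * ((k : ℝ) + 1) + 1 ≠ 0 := by positivity
    field_simp
    ring

theorem ultraInt_odd_one (k : ℕ) :
    ultraInt (2 * k + 1) 1 =
      π / (2 * 4 ^ k) * (2 * k + 1).factorial / ((k + 1) * (k.factorial : ℝ) ^ 2) := by
  induction k with
  | zero => simp [ultraInt_one_one]
  | succ k ih =>
    have h := ultraInt_add_two_one (2 * k + 1)
    rw [ih] at h
    have h₁ : ((2 * k + 1 : ℕ) : ℝ) + 3 ≠ 0 := by positivity
    refine mul_left_cancel₀ h₁ (h.trans ?_)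
    rw [show 2 * (k + 1) + 1 = 2 * k + 1 + 1 + 1 by ring, Nat.factorial_succ (2 * k + 1 + 1),
      Nat.factorial_succ (2 * k + 1), Nat.factorial_succ k]
    push_cast
    have h₂ : (k : ℝ) + 1 + 1 ≠ 0 := by positivity
    field_simp
    ring

theorem ultraInt_gegenbauer_sq (k m : ℕ) :
    ultraInt (2 * k + 1) (gegenbauerPoly ((k : ℝ) + 1) m ^ 2) =
      π / (2 * 4 ^ k) * (m + 2 * k + 1).factorial /
        ((m + k + 1) * (k.factorial : ℝ) ^ 2 * m.factorial) := by
  induction m with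
  | zero => simp [gegenbauerPoly, ultraInt_odd_one]
  | succ m ih =>
    have h := ultraInt_gegenbauer_sq_succ (2 * k + 1) m
    have hl : (((2 * k + 1 : ℕ) : ℝ) + 1) / 2 = k + 1 := by push_cast; ring
    rw [hl, ih] at h
    have h₁ : (m : ℝ) + 1 ≠ 0 := by positivity
    have h₂ : 2 * (m : ℝ) + ((2 * k + 1 : ℕ) : ℝ) + 3 ≠ 0 := by positivity
    refine mul_left_cancel₀ (mul_ne_zero h₁ h₂) (h.trans ?_)
    rw [show m + 1 + 2 * k + 1 = m + 2 * k + 1 + 1 by ring, Nat.factorial_succ (m + 2 * k + 1),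
      Nat.factorial_succ m]
    push_cast
    have h₃ : (m : ℝ) + 1 + k + 1 ≠ 0 := by positivity
    have h₄ : (m : ℝ) + k + 1 ≠ 0 := by positivity
    field_simp
    ring

end Norm

theorem continuous_gegenbauer (lam : ℝ) (n : ℕ) : Continuous (gegenbauer lam n) := by
  have h : gegenbauer lam n = fun t ↦ (gegenbauerPoly lam n).eval t :=
    funext fun t ↦ (eval_gegenbauerPoly lam n t).symm
  rw [h]
  exact (gegenbauerPoly lam n).continuous

theorem isOpen_unitDisk : IsOpen unitDisk :=
  isOpen_lt (by fun_prop) continuous_const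

theorem unitDisk_subset : unitDisk ⊆ Set.Icc (-1) 1 ×ˢ Set.Icc (-1) 1 := by
  intro p hp
  have hp' : p.1 ^ 2 + p.2 ^ 2 < 1 := hp
  simp only [Set.mem_prod, Set.mem_Icc]
  refine ⟨abs_le.1 (abs_le_of_sq_le_sq ?_ zero_le_one),
    abs_le.1 (abs_le_of_sq_le_sq ?_ zero_le_one)⟩ <;> nlinarith [sq_nonneg p.1, sq_nonneg p.2]

theorem one_sub_sq_pos_of_mem_unitDisk {p : ℝ × ℝ} (hp : p ∈ unitDisk) : 0 < 1 - p.1 ^ 2 := by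
  have hp' : p.1 ^ 2 + p.2 ^ 2 < 1 := hp
  nlinarith [sq_nonneg p.2]

theorem integrableOn_unitDisk {f g : ℝ → ℝ} (hf : Continuous f) (hg : Continuous g) :
    IntegrableOn (fun p : ℝ × ℝ ↦ f p.1 * g (p.2 / √(1 - p.1 ^ 2))) unitDisk := by
  obtain ⟨M, hM⟩ := isCompact_Icc.exists_bound_of_continuousOn (s := Set.Icc (-1 : ℝ) 1)
    hf.continuousOn
  obtain ⟨N, hN⟩ := isCompact_Icc.exists_bound_of_continuousOn (s := Set.Icc (-1 : ℝ) 1)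
    hg.continuousOn
  have hcont : ContinuousOn (fun p : ℝ × ℝ ↦ f p.1 * g (p.2 / √(1 - p.1 ^ 2))) unitDisk := by
    refine (hf.comp continuous_fst).continuousOn.mul (hg.comp_continuousOn ?_)
    exact continuous_snd.continuousOn.div (by fun_prop)
      fun p hp ↦ (Real.sqrt_pos.2 (one_sub_sq_pos_of_mem_unitDisk hp)).ne'
  have hfin : volume unitDisk < ⊤ :=
    (measure_mono unitDisk_subset).trans_lt (isCompact_Icc.prod isCompact_Icc).measure_lt_top
  refine IntegrableOn.of_bound hfin
    (hcont.aestronglyMeasurable isOpen_unitDisk.measurableSet) (M * N) ?_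
  refine (ae_restrict_iff' isOpen_unitDisk.measurableSet).2 (Eventually.of_forall fun p hp ↦ ?_)
  have hx := (unitDisk_subset hp).1
  have hpos := one_sub_sq_pos_of_mem_unitDisk hp
  have hy : p.2 / √(1 - p.1 ^ 2) ∈ Set.Icc (-1 : ℝ) 1 := by
    refine abs_le.1 (abs_le_of_sq_le_sq ?_ zero_le_one)
    rw [div_pow, Real.sq_sqrt hpos.le, div_le_iff₀ hpos]
    have hp' : p.1 ^ 2 + p.2 ^ 2 < 1 := hp
    linarith
  rw [norm_mul]
  exact mul_le_mul (hM _ hx) (hN _ hy) (norm_nonneg _) ((norm_nonneg _).trans (hM _ hx))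

theorem integral_unitDisk_mul_div {f g : ℝ → ℝ} (hf : Continuous f) (hg : Continuous g) :
    ∫ p in unitDisk, f p.1 * g (p.2 / √(1 - p.1 ^ 2)) =
      (∫ x in (-1 : ℝ)..1, f x * √(1 - x ^ 2)) * ∫ t in (-1 : ℝ)..1, g t := by
  have hint := (integrableOn_unitDisk hf hg).integrable_indicator isOpen_unitDisk.measurableSet
  rw [← integral_indicator isOpen_unitDisk.measurableSet, Measure.volume_eq_prod,
    integral_prod _ (by rwa [← Measure.volume_eq_prod]), ← intervalIntegral.integral_mul_const,
    intervalIntegral.integral_of_le (by norm_num), integral_Ioc_eq_integral_Ioo,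
    ← integral_indicator measurableSet_Ioo]
  congr 1 with x
  by_cases hx : x ∈ Set.Ioo (-1 : ℝ) 1
  · have hpos : 0 < 1 - x ^ 2 := by nlinarith [hx.1, hx.2]
    have hs := Real.sqrt_pos.2 hpos
    have hi : (fun y ↦ unitDisk.indicator
          (fun p : ℝ × ℝ ↦ f p.1 * g (p.2 / √(1 - p.1 ^ 2))) (x, y)) =
        (Set.Ioo (-√(1 - x ^ 2)) (√(1 - x ^ 2))).indicator
          fun y ↦ f x * g (y / √(1 - x ^ 2)) := by
      ext y
      have : (x, y) ∈ unitDisk ↔ y ∈ Set.Ioo (-√(1 - x ^ 2)) (√(1 - x ^ 2)) := by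
        rw [Set.mem_Ioo, ← abs_lt, Real.lt_sqrt (abs_nonneg y), sq_abs, lt_sub_iff_add_lt']
        rfl
      simp only [Set.indicator, this]
    rw [hi, integral_indicator measurableSet_Ioo, ← integral_Ioc_eq_integral_Ioo,
      ← intervalIntegral.integral_of_le (by linarith), intervalIntegral.integral_const_mul,
      intervalIntegral.integral_comp_div g hs.ne', Set.indicator_of_mem hx, neg_div,
      div_self hs.ne', smul_eq_mul, mul_assoc]
  · rw [Set.indicator_of_notMem hx]
    refine integral_eq_zero_of_ae (Eventually.of_forall fun y ↦ Set.indicator_of_notMem ?_ _)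
    intro hp
    have hpos : 0 < 1 - x ^ 2 := one_sub_sq_pos_of_mem_unitDisk hp
    exact hx (abs_lt.1 ((sq_lt_one_iff_abs_lt_one x).1 (by linarith)))

/-- `h_{k,n}²` is the squared `L²(𝔹₂)`-norm of the unnormalized
basis function. -/
theorem hConst_sq_eq_norm (n k : ℕ) (hk : k ≤ n) :
    (∫ p in unitDisk,
        (gegenbauer ((k : ℝ) + 1) (n - k) p.1) ^ 2 * (1 - p.1 ^ 2) ^ k *
          (gegenbauer (1 / 2) k (p.2 / Real.sqrt (1 - p.1 ^ 2))) ^ 2) =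
      (π / 4 ^ k) * (Nat.factorial (n + k + 1)) /
        (((n : ℝ) + 1) * (2 * (k : ℝ) + 1) * ((Nat.factorial k : ℝ)) ^ 2 *
          (Nat.factorial (n - k) : ℝ)) := by
  obtain ⟨m, rfl⟩ := Nat.exists_eq_add_of_le hk
  rw [Nat.add_sub_cancel_left]
  have h := integral_unitDisk_mul_div
    (f := fun x ↦ gegenbauer ((k : ℝ) + 1) m x ^ 2 * (1 - x ^ 2) ^ k)
    (g := fun t ↦ gegenbauer (1 / 2) k t ^ 2)
    (((continuous_gegenbauer _ _).pow 2).mul (by fun_prop)) ((continuous_gegenbauer _ _).pow 2)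
  have hx : ∫ x in (-1 : ℝ)..1, gegenbauer ((k : ℝ) + 1) m x ^ 2 * (1 - x ^ 2) ^ k * √(1 - x ^ 2)
      = ultraInt (2 * k + 1) (gegenbauerPoly ((k : ℝ) + 1) m ^ 2) := by
    refine intervalIntegral.integral_congr fun x hx ↦ ?_
    rw [Set.uIcc_of_le (by norm_num)] at hx
    have hpos : 0 ≤ 1 - x ^ 2 := by nlinarith [hx.1, hx.2]
    simp only [Polynomial.eval_pow, eval_gegenbauerPoly]
    rw [pow_succ (√(1 - x ^ 2)), pow_mul, Real.sq_sqrt hpos, mul_assoc]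
  have ht : ∫ t in (-1 : ℝ)..1, gegenbauer (1 / 2) k t ^ 2
      = ultraInt 0 (gegenbauerPoly (1 / 2) k ^ 2) := by
    simp [ultraInt, eval_gegenbauerPoly]
  rw [h, hx, ht, ultraInt_gegenbauer_sq, ultraInt_legendre_sq,
    show k + m + k + 1 = m + 2 * k + 1 by ring]
  push_cast
  have h₁ : (m : ℝ) + k + 1 ≠ 0 := by positivity
  have h₂ : (k : ℝ) + m + 1 ≠ 0 := by positivity
  field_simp
  ring
end
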